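/- Let k be a field and G a finite abelian group with square roots (for every g ∈ G there is h ∈ G with h² = g). Let WRQF(G,kˣ) be the set of triples (q, η, g₀) where q is a quadratic form, η is a character, g₀ ∈ G, and η(g) = β_q(g,g₀) for all g, with (q,η,g₀) ∼ (q',η',g₀') iff there exists f ∈ Aut(G) with q·η = (q'·η') ∘ f and f(g₀) = g₀'. Let WSQF(G,kˣ) be the set of pairs (q, g₀) where q is a weak quadratic form with q(g) = q(g⁻¹g₀) for all g, with (q,g₀) ∼ (q',g₀') iff there exists f ∈ Aut(G) with q = q' ∘ f and f(g₀) = g₀'. Then the map sending [(q, η, g₀)] to [(q·η, g₀⁻²)] is a well-defined bijection from WRQF(G,kˣ)/∼ to WSQF(G,kˣ)/∼. -/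

import Mathlib

/-- The map `β_q` associated to a map `q : G → kˣ`,
`β_q(a,b) = q(ab)·q(a)⁻¹·q(b)⁻¹`. -/
def betaMul {k : Type*} [Field k] {G : Type*} [Group G] (q : G → kˣ) (a b : G) : kˣ :=
  q (a * b) * (q a)⁻¹ * (q b)⁻¹

/-- `q` is a weak quadratic form iff `β_q` is a bihomomorphism. -/
def IsWeakQuadraticForm {k : Type*} [Field k] {G : Type*} [Group G] (q : G → kˣ) : Prop :=
  (∀ a b c : G, betaMul q (a * b) c = betaMul q a c * betaMul q b c) ∧
  (∀ a b c : G, betaMul q a (b * c) = betaMul q a b * betaMul q a c)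

/-- A quadratic form is a weak quadratic form with `q(g) = q(g⁻¹)` for all `g`. -/
def IsQuadraticForm {k : Type*} [Field k] {G : Type*} [Group G] (q : G → kˣ) : Prop :=
  IsWeakQuadraticForm q ∧ ∀ g : G, q g = q g⁻¹

/-- `WRQF(G,kˣ)`: triples `(q, η, g₀)` of a quadratic form `q`, a character `η`, and
`g₀ ∈ G` such that `η(g) = β_q(g,g₀)` for all `g`. -/
def WRQF (k : Type*) [Field k] (G : Type*) [Group G] : Type _ :=
  {t : (G → kˣ) × (G →* kˣ) × G //
    IsQuadraticForm t.1 ∧ ∀ g : G, t.2.1 g = betaMul t.1 g t.2.2}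

/-- `WSQF(G,kˣ)`: pairs `(q, g₀)` of a weak quadratic form `q` and `g₀ ∈ G` such that
`q(g) = q(g⁻¹g₀)` for all `g`. -/
def WSQF (k : Type*) [Field k] (G : Type*) [Group G] : Type _ :=
  {p : (G → kˣ) × G // IsWeakQuadraticForm p.1 ∧ ∀ g : G, p.1 g = p.1 (g⁻¹ * p.2)}

/-- Equivalence on `WRQF`: `(q,η,g₀) ∼ (q',η',g₀')` iff there is `f ∈ Aut(G)` with
`q·η = (q'·η') ∘ f` and `f(g₀) = g₀'`. -/
def wrqfRel {k : Type*} [Field k] {G : Type*} [Group G] (t₁ t₂ : WRQF k G) : Prop :=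
  ∃ f : G ≃* G,
    (∀ g : G, t₁.1.1 g * t₁.1.2.1 g = t₂.1.1 (f g) * t₂.1.2.1 (f g)) ∧
    f t₁.1.2.2 = t₂.1.2.2

/-- Equivalence on `WSQF`: `(q,g₀) ∼ (q',g₀')` iff there is `f ∈ Aut(G)` with
`q = q' ∘ f` and `f(g₀) = g₀'`. -/
def wsqfRel {k : Type*} [Field k] {G : Type*} [Group G] (p₁ p₂ : WSQF k G) : Prop :=
  ∃ f : G ≃* G, (∀ g : G, p₁.1.1 g = p₂.1.1 (f g)) ∧ f p₁.1.2 = p₂.1.2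

section

variable {k : Type*} [Field k] {G : Type*} [CommGroup G]

lemma apply_mul_eq_betaMul (q : G → kˣ) (a b : G) : q (a * b) = q a * q b * betaMul q a b := by
  unfold betaMul
  ext
  push_cast
  field_simp

/-- Multiplying a map by a character does not change its associated form. -/
lemma betaMul_mul_char (q : G → kˣ) (η : G →* kˣ) :
    betaMul (fun g => q g * η g) = betaMul q := by
  ext a b : 2
  simp only [betaMul, map_mul, mul_inv]
  calc _ = q (a * b) * (q a)⁻¹ * (q b)⁻¹ * ((η a * (η a)⁻¹) * (η b * (η b)⁻¹)) := by
        simp only [mul_assoc, mul_left_comm]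
    _ = _ := by simp

lemma IsWeakQuadraticForm.mul_char {q : G → kˣ} (hq : IsWeakQuadraticForm q) (η : G →* kˣ) :
    IsWeakQuadraticForm (fun g => q g * η g) := by
  unfold IsWeakQuadraticForm
  rw [betaMul_mul_char]
  exact hq

/-- The character `g ↦ β_q(g, u)` of a weak quadratic form `q`. -/
def IsWeakQuadraticForm.betaChar {q : G → kˣ} (hq : IsWeakQuadraticForm q) (u : G) : G →* kˣ :=
  MonoidHom.mk' (fun g => betaMul q g u) fun a b => hq.1 a b u

@[simp]
lemma IsWeakQuadraticForm.betaChar_apply {q : G → kˣ} (hq : IsWeakQuadraticForm q) (u g : G) :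
    hq.betaChar u g = betaMul q g u := rfl

lemma IsWeakQuadraticForm.betaMul_inv_left {q : G → kˣ} (hq : IsWeakQuadraticForm q) (a b : G) :
    betaMul q a⁻¹ b = (betaMul q a b)⁻¹ :=
  map_inv (hq.betaChar b) a

lemma betaMul_comm (q : G → kˣ) (a b : G) : betaMul q a b = betaMul q b a := by
  unfold betaMul
  rw [mul_comm a b, mul_right_comm]

lemma IsWeakQuadraticForm.betaMul_inv_right {q : G → kˣ} (hq : IsWeakQuadraticForm q) (a b : G) :
    betaMul q a b⁻¹ = (betaMul q a b)⁻¹ := by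
  rw [betaMul_comm, hq.betaMul_inv_left, betaMul_comm]

lemma IsWeakQuadraticForm.map_one {q : G → kˣ} (hq : IsWeakQuadraticForm q) : q 1 = 1 := by
  have h : betaMul q 1 1 = 1 := _root_.map_one (hq.betaChar 1)
  simpa [betaMul] using h

lemma IsQuadraticForm.betaMul_self {q : G → kˣ} (hq : IsQuadraticForm q) (a : G) :
    betaMul q a a = q a ^ 2 := by
  have h := apply_mul_eq_betaMul q a a⁻¹
  rw [mul_inv_cancel, hq.1.map_one, ← hq.2, hq.1.betaMul_inv_right, ← pow_two] at h
  exact (mul_inv_eq_one.mp h.symm).symm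

lemma IsQuadraticForm.map_inv_mul_mul_char {q : G → kˣ} (hq : IsQuadraticForm q) {η : G →* kˣ}
    {u : G} (hη : ∀ g, η g = betaMul q g u) (g : G) :
    q g * η g = q (g⁻¹ * (u ^ 2)⁻¹) * η (g⁻¹ * (u ^ 2)⁻¹) := by
  have h₁ : q (g⁻¹ * (u ^ 2)⁻¹) = q (g * u * u) := by
    rw [hq.2, mul_inv, inv_inv, inv_inv, pow_two, mul_assoc]
  have hu : η u = q u ^ 2 := by rw [hη, hq.betaMul_self]
  rw [h₁, apply_mul_eq_betaMul q (g * u) u, apply_mul_eq_betaMul q g u, ← hη, ← hη, map_mul,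
    map_mul, map_inv, map_inv, map_pow, hu]
  ext
  push_cast
  field_simp

lemma IsWeakQuadraticForm.isQuadraticForm_mul_betaChar_inv {q : G → kˣ}
    (hq : IsWeakQuadraticForm q) {u : G} (hu : ∀ g, q g = q (g⁻¹ * (u ^ 2)⁻¹)) :
    IsQuadraticForm (fun g => q g * (hq.betaChar u)⁻¹ g) := by
  refine ⟨hq.mul_char _, fun g => ?_⟩
  have h₁ : q (u ^ 2)⁻¹ = 1 := by
    have h := hu 1
    rwa [inv_one, one_mul, hq.map_one, eq_comm] at h
  have h₂ : q g = q g⁻¹ * betaMul q g u ^ 2 := by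
    rw [hu g, apply_mul_eq_betaMul q g⁻¹, h₁, mul_one, hq.betaMul_inv_left, hq.betaMul_inv_right, inv_inv,
      pow_two, hq.2, pow_two]
  simp only [MonoidHom.inv_apply, betaChar_apply, hq.betaMul_inv_left, inv_inv]
  rw [h₂, pow_two, mul_assoc, mul_inv_cancel_right]

/-- The map `(q, η, g₀) ↦ (q·η, g₀⁻²)`. -/
def wrqfToWSQF (t : WRQF k G) : WSQF k G :=
  ⟨(fun g => t.1.1 g * t.1.2.1 g, (t.1.2.2 ^ 2)⁻¹),
    t.2.1.1.mul_char _, t.2.1.map_inv_mul_mul_char t.2.2⟩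

lemma wrqfToWSQF_injective (hsq : Function.Injective fun g : G => g ^ 2) :
    Function.Injective (wrqfToWSQF (k := k) (G := G)) := by
  rintro ⟨⟨q, η, u⟩, hq, hη⟩ ⟨⟨q', η', u'⟩, hq', hη'⟩ h
  obtain ⟨h₁, h₂⟩ := Prod.ext_iff.mp (Subtype.ext_iff.mp h)
  dsimp only [wrqfToWSQF] at hη hη' h₁ h₂
  obtain rfl : u = u' := hsq (inv_injective h₂)
  obtain rfl : η = η' := by
    ext1 g
    rw [hη, hη', ← betaMul_mul_char q η, h₁, betaMul_mul_char]
  obtain rfl : q = q' := funext fun g => mul_right_cancel (congrFun h₁ g)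
  rfl

lemma wrqfToWSQF_surjective (hsq : Function.Surjective fun g : G => g ^ 2) :
    Function.Surjective (wrqfToWSQF (k := k) (G := G)) := by
  rintro ⟨⟨q, v⟩, hq, hv⟩
  obtain ⟨u, hu⟩ := hsq v⁻¹
  obtain rfl : v = (u ^ 2)⁻¹ := inv_eq_iff_eq_inv.mp hu.symm
  refine ⟨⟨(fun g => q g * (hq.betaChar u)⁻¹ g, hq.betaChar u, u),
    hq.isQuadraticForm_mul_betaChar_inv hv, fun g => ?_⟩, Subtype.ext (Prod.ext ?_ rfl)⟩
  · rw [betaMul_mul_char]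
    rfl
  · funext g
    simp [wrqfToWSQF]

lemma wrqfRel_iff_wsqfRel (hsq : Function.Injective fun g : G => g ^ 2) (t₁ t₂ : WRQF k G) :
    wrqfRel t₁ t₂ ↔ wsqfRel (wrqfToWSQF t₁) (wrqfToWSQF t₂) := by
  refine exists_congr fun f => and_congr_right fun _ => ?_
  simp only [wrqfToWSQF, map_inv, map_pow, inv_inj]
  exact hsq.eq_iff.symm

end

/-- For a finite abelian group `G` with square roots, the map
`[(q, η, g₀)] ↦ [(q·η, g₀⁻²)]` is a well-defined bijection
`WRQF(G,kˣ)/∼ → WSQF(G,kˣ)/∼`. -/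
theorem statement_14 {k : Type*} [Field k] {G : Type*} [CommGroup G] [Finite G]
    (hroots : ∀ g : G, ∃ h : G, h * h = g) :
    ∃ e : Quot (wrqfRel (k := k) (G := G)) ≃ Quot (wsqfRel (k := k) (G := G)),
      ∀ t : WRQF k G, ∃ p : WSQF k G,
        (∀ g : G, p.1.1 g = t.1.1 g * t.1.2.1 g) ∧
        p.1.2 = (t.1.2.2 ^ 2)⁻¹ ∧
        e (Quot.mk _ t) = Quot.mk _ p := by
  have hsurj : Function.Surjective fun g : G => g ^ 2 := fun g =>
    (hroots g).imp fun h hh => (pow_two h).trans hh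
  have hinj := Finite.injective_iff_surjective.mpr hsurj
  exact ⟨Quot.congr (Equiv.ofBijective wrqfToWSQF
      ⟨wrqfToWSQF_injective hinj, wrqfToWSQF_surjective hsurj⟩) (wrqfRel_iff_wsqfRel hinj),
    fun t => ⟨wrqfToWSQF t, fun _ => rfl, rfl, rfl⟩⟩
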